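/- arXiv:2312.03435 — 4 statements merged into one kernel-verified Lean document; each statement's English description precedes it below -/
import Mathlib

section
/- (Variance, Theorem 2, exact formula) Let E be a finite set with |E| = n, let B be a butterfly family on E, let 8 ≤ k ≤ n, let S be a uniform k-sample of E, let γ = C(n,k)/C(n−4,k−4), and let c(S) = γ · |{b ∈ B : b ⊆ S}|. For m ∈ {0, 1, 2}, let y_m denote the number of unordered pairs of distinct members of B whose intersection has exactly m elements. Then Var[c] = γ·E[c] − E[c]² + 2γ² · ( y₀ · C(n−8,k−8)/C(n,k) + y₁ · C(n−7,k−7)/C(n,k) + y₂ · C(n−6,k−6)/C(n,k) ). -/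
open Finset in
/-- For a symmetric relation, ordered off-diagonal pairs are twice as many as unordered ones. -/
theorem Finset.card_filter_offDiag_eq_two_mul {β : Type*} [DecidableEq β] (B : Finset β)
    (r : β → β → Prop) [DecidableRel r] (hr : ∀ a b, r a b → r b a) :
    #{p ∈ B.offDiag | r p.1 p.2} =
      2 * #{P ∈ B.powersetCard 2 | ∀ a ∈ P, ∀ b ∈ P, a ≠ b → r a b} := by
  have hmaps : ∀ p ∈ B.offDiag.filter (fun p => r p.1 p.2), ({p.1, p.2} : Finset β) ∈
      (B.powersetCard 2).filter (fun P => ∀ a ∈ P, ∀ b ∈ P, a ≠ b → r a b) := by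
    rintro ⟨a, b⟩ hp
    simp only [mem_filter, mem_offDiag] at hp
    obtain ⟨⟨ha, hb, hab⟩, h⟩ := hp
    have h' := hr _ _ h
    simp only [mem_filter, mem_powersetCard]
    refine ⟨⟨by simp [insert_subset_iff, ha, hb], card_pair hab⟩, ?_⟩
    intro x hx y hy hxy
    simp only [mem_insert, mem_singleton] at hx hy
    rcases hx with rfl | rfl <;> rcases hy with rfl | rfl <;>
      first | assumption | exact absurd rfl hxy
  rw [card_eq_sum_card_fiberwise (f := fun p : β × β => ({p.1, p.2} : Finset β)) hmaps,
    sum_const_nat (m := 2), mul_comm]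
  intro P hP
  simp only [mem_filter, mem_powersetCard] at hP
  obtain ⟨⟨hPB, hP2⟩, h⟩ := hP
  obtain ⟨a, b, hab, rfl⟩ := card_eq_two.1 hP2
  have hfib : ((B.offDiag.filter (fun p => r p.1 p.2)).filter
      (fun p : β × β => ({p.1, p.2} : Finset β) = {a, b})) = {(a, b), (b, a)} := by
    have ha : a ∈ B := hPB (by simp)
    have hb : b ∈ B := hPB (by simp)
    have hrab : r a b := h a (by simp) b (by simp) hab
    have hrba := hr _ _ hrab
    ext ⟨x, y⟩
    simp only [mem_filter, mem_offDiag, mem_insert, mem_singleton, Prod.mk.injEq]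
    constructor
    · rintro ⟨⟨⟨_, _, hxy⟩, _⟩, he⟩
      have hx : x ∈ ({a, b} : Finset β) := he ▸ by simp
      have hy : y ∈ ({a, b} : Finset β) := he ▸ by simp
      simp only [mem_insert, mem_singleton] at hx hy
      grind
    · rintro (⟨rfl, rfl⟩ | ⟨rfl, rfl⟩)
      · exact ⟨⟨⟨ha, hb, hab⟩, hrab⟩, rfl⟩
      · exact ⟨⟨⟨hb, ha, hab.symm⟩, hrba⟩, pair_comm _ _⟩
  rw [hfib, card_pair]
  simp [hab]

open Finset in
/-- Double counting of the members of `B` contained in the `k`-subsets of `E`. -/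
theorem Finset.sum_card_filter_subset_powersetCard {α : Type*} [DecidableEq α] (E : Finset α)
    (B : Finset (Finset α)) {k r : ℕ} (hB : ∀ b ∈ B, b ⊆ E ∧ #b = r) (hr : r ≤ k) :
    ∑ S ∈ E.powersetCard k, #{b ∈ B | b ⊆ S} = #B * (#E - r).choose (k - r) := by
  refine (sum_card_bipartiteAbove_eq_sum_card_bipartiteBelow
    (fun S b : Finset α => b ⊆ S)).trans (sum_const_nat fun b hb => ?_)
  obtain ⟨hbE, rfl⟩ := hB b hb
  exact card_filter_powersetCard_subset _ _ _ hbE hr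

open Finset in
/-- Double counting of the ordered pairs of members of `B` contained in the `k`-subsets of `E`. -/
theorem Finset.sum_card_filter_subset_sq_powersetCard {α : Type*} [DecidableEq α] (E : Finset α)
    (B : Finset (Finset α)) {k : ℕ} (hB : ∀ b ∈ B, b ⊆ E ∧ 2 * #b ≤ k) :
    ∑ S ∈ E.powersetCard k, #{b ∈ B | b ⊆ S} ^ 2 =
      ∑ p ∈ B ×ˢ B, (#E - #(p.1 ∪ p.2)).choose (k - #(p.1 ∪ p.2)) := by
  have hsq : ∀ S : Finset α, #{b ∈ B | b ⊆ S} ^ 2 = #{p ∈ B ×ˢ B | p.1 ∪ p.2 ⊆ S} := by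
    intro S
    rw [sq, ← card_product, ← filter_product]
    simp only [union_subset_iff]
  simp_rw [hsq]
  refine (sum_card_bipartiteAbove_eq_sum_card_bipartiteBelow
    (fun (S : Finset α) (p : Finset α × Finset α) => p.1 ∪ p.2 ⊆ S)).trans
    (sum_congr rfl fun p hp => ?_)
  obtain ⟨h₁, h₂⟩ := mem_product.1 hp
  refine card_filter_powersetCard_subset _ _ _
    (union_subset (hB _ h₁).1 (hB _ h₂).1) ((card_union_le _ _).trans ?_)
  have := (hB _ h₁).2
  have := (hB _ h₂).2
  omega

open Finset in
/-- The second moment of a butterfly family, before normalisation. -/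
theorem sum_card_filter_subset_sq_of_butterfly {α : Type*} [DecidableEq α] (E : Finset α)
    (B : Finset (Finset α)) {k : ℕ} (hk : 8 ≤ k) (hB : ∀ b ∈ B, b ⊆ E ∧ #b = 4)
    (hBint : ∀ b ∈ B, ∀ b' ∈ B, b ≠ b' → #(b ∩ b') ≤ 2) :
    ∑ S ∈ E.powersetCard k, #{b ∈ B | b ⊆ S} ^ 2 =
      #B * (#E - 4).choose (k - 4) + ∑ m ∈ range 3,
        2 * #{P ∈ B.powersetCard 2 | ∀ a ∈ P, ∀ b ∈ P, a ≠ b → #(a ∩ b) = m} *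
          (#E - (8 - m)).choose (k - (8 - m)) := by
  rw [sum_card_filter_subset_sq_powersetCard E B
      fun b hb => ⟨(hB b hb).1, by have := (hB b hb).2; omega⟩,
    ← diag_union_offDiag, sum_union (disjoint_diag_offDiag B), sum_diag]
  congr 1
  · refine sum_const_nat fun b hb => ?_
    rw [union_self, (hB b hb).2]
  · rw [← sum_fiberwise_of_maps_to (t := range 3) (g := fun p => #(p.1 ∩ p.2))]
    · refine sum_congr rfl fun m _ => ?_
      rw [← card_filter_offDiag_eq_two_mul B (fun a b => #(a ∩ b) = m)
        fun a b h => by rwa [inter_comm]]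
      refine sum_const_nat fun p hp => ?_
      obtain ⟨hp, hm⟩ := mem_filter.1 hp
      obtain ⟨h₁, h₂, -⟩ := mem_offDiag.1 hp
      rw [card_union, hm, (hB _ h₁).2, (hB _ h₂).2]
    · intro p hp
      obtain ⟨h₁, h₂, hne⟩ := mem_offDiag.1 hp
      exact mem_range.2 (Nat.lt_succ_of_le (hBint _ h₁ _ h₂ hne))

/-- Variance (Theorem 2, exact formula): for a butterfly family `B` on `E` with
`|E| = n`, `8 ≤ k ≤ n`, a uniform `k`-sample `S` of `E`, `γ = C(n,k)/C(n−4,k−4)`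
and the estimator `c(S) = γ · |{b ∈ B : b ⊆ S}|`, writing `y m` for the number of
unordered pairs of distinct members of `B` whose intersection has exactly `m` elements,
`Var[c] = γ·E[c] − E[c]² + 2γ²·(y₀·C(n−8,k−8)/C(n,k) + y₁·C(n−7,k−7)/C(n,k)
  + y₂·C(n−6,k−6)/C(n,k))`. -/
theorem abacus_variance_exact
    {α : Type*} [DecidableEq α] (E : Finset α) (n k : ℕ) (B : Finset (Finset α))
    (hE : E.card = n) (hk8 : 8 ≤ k) (hkn : k ≤ n)
    (hB : ∀ b ∈ B, b ⊆ E ∧ b.card = 4)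
    (hBint : ∀ b ∈ B, ∀ b' ∈ B, b ≠ b' → (b ∩ b').card ≤ 2) :
    let γ : ℝ := (Nat.choose n k : ℝ) / (Nat.choose (n - 4) (k - 4) : ℝ)
    let c : Finset α → ℝ := fun S => γ * ((B.filter (fun b => b ⊆ S)).card : ℝ)
    let Exp : (Finset α → ℝ) → ℝ :=
      fun f => (∑ S ∈ E.powersetCard k, f S) / ((E.powersetCard k).card : ℝ)
    let y : ℕ → ℕ := fun m =>
      ((B.powersetCard 2).filter
        (fun P => ∀ a ∈ P, ∀ b ∈ P, a ≠ b → (a ∩ b).card = m)).card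
    Exp (fun S => (c S - Exp c) ^ 2) =
      γ * Exp c - (Exp c) ^ 2 +
        2 * γ ^ 2 *
          ((y 0 : ℝ) * (Nat.choose (n - 8) (k - 8) : ℝ) / (Nat.choose n k : ℝ) +
           (y 1 : ℝ) * (Nat.choose (n - 7) (k - 7) : ℝ) / (Nat.choose n k : ℝ) +
           (y 2 : ℝ) * (Nat.choose (n - 6) (k - 6) : ℝ) / (Nat.choose n k : ℝ)) := by
  intro γ c Exp y
  have hN : (n.choose k : ℝ) ≠ 0 := by exact_mod_cast (Nat.choose_pos hkn).ne'
  have hD : ((n - 4).choose (k - 4) : ℝ) ≠ 0 := by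
    exact_mod_cast (Nat.choose_pos (Nat.sub_le_sub_right hkn 4)).ne'
  have hcard : ((E.powersetCard k).card : ℝ) = n.choose k := by
    rw [Finset.card_powersetCard, hE]
  have h₁ : ∑ S ∈ E.powersetCard k, ((B.filter (fun b => b ⊆ S)).card : ℝ) =
      B.card * (n - 4).choose (k - 4) := by
    rw [← hE]
    exact_mod_cast Finset.sum_card_filter_subset_powersetCard E B hB (by omega)
  have h₂ : ∑ S ∈ E.powersetCard k, ((B.filter (fun b => b ⊆ S)).card : ℝ) ^ 2 =
      B.card * (n - 4).choose (k - 4) + (2 * y 0 * (n - 8).choose (k - 8) +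
        2 * y 1 * (n - 7).choose (k - 7) + 2 * y 2 * (n - 6).choose (k - 6)) := by
    have h := sum_card_filter_subset_sq_of_butterfly E B hk8 hB hBint
    simp only [Finset.sum_range_succ, Finset.sum_range_zero, zero_add, hE] at h
    exact_mod_cast h
  have hmean : Exp c = B.card := by
    simp only [Exp, c, γ]
    rw [← Finset.mul_sum, h₁, hcard]
    field_simp
  have hvar : Exp (fun S => (c S - Exp c) ^ 2) =
      (γ ^ 2 * ∑ S ∈ E.powersetCard k, ((B.filter (fun b => b ⊆ S)).card : ℝ) ^ 2 -
        2 * γ * B.card * ∑ S ∈ E.powersetCard k, ((B.filter (fun b => b ⊆ S)).card : ℝ) +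
        n.choose k * (B.card : ℝ) ^ 2) / n.choose k := by
    rw [hmean]
    simp only [Exp]
    rw [← hcard, ← nsmul_eq_mul (E.powersetCard k).card, ← Finset.sum_const,
      Finset.mul_sum, Finset.mul_sum, ← Finset.sum_sub_distrib, ← Finset.sum_add_distrib]
    congr 1
    refine Finset.sum_congr rfl fun S _ => ?_
    simp only [c]
    ring
  rw [hvar, hmean, h₁, h₂]
  simp only [γ]
  field_simp
  ring
end

section
/- (Variance upper bound, Theorem 2) Let E be a finite set with |E| = n, let B be a butterfly family on E, let 8 ≤ k ≤ n, let S be a uniform k-sample of E, let γ = C(n,k)/C(n−4,k−4), and let c(S) = γ · |{b ∈ B : b ⊆ S}|. Then Var[c] ≤ γ·E[c] + 2γ² · C(E[c], 2) · C(n−6,k−6)/C(n,k) − E[c]², where C(E[c], 2) = E[c]·(E[c]−1)/2 and E[c] = |B|. -/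
theorem card_filter_superset_powersetCard {α : Type*} [DecidableEq α] {E b : Finset α} {k : ℕ}
    (hb : b ⊆ E) (hk : b.card ≤ k) :
    ((E.powersetCard k).filter (fun S => b ⊆ S)).card =
      (E.card - b.card).choose (k - b.card) := by
  rw [← Finset.card_sdiff_of_subset hb, ← Finset.card_powersetCard]
  refine Finset.card_bij' (fun S _ => S \ b) (fun T _ => T ∪ b) ?_ ?_ ?_ ?_
  · intro S hS
    simp only [Finset.mem_filter, Finset.mem_powersetCard] at hS ⊢
    exact ⟨Finset.sdiff_subset_sdiff hS.1.1 subset_rfl,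
      by rw [Finset.card_sdiff_of_subset hS.2, hS.1.2]⟩
  · intro T hT
    simp only [Finset.mem_filter, Finset.mem_powersetCard] at hT ⊢
    have hd : Disjoint T b := Finset.disjoint_of_subset_left hT.1 Finset.sdiff_disjoint
    refine ⟨⟨Finset.union_subset (hT.1.trans Finset.sdiff_subset) hb, ?_⟩,
      Finset.subset_union_right⟩
    rw [Finset.card_union_of_disjoint hd, hT.2]
    omega
  · intro S hS
    exact Finset.sdiff_union_of_subset (Finset.mem_filter.1 hS).2
  · intro T hT
    have hd : Disjoint T b :=
      Finset.disjoint_of_subset_left (Finset.mem_powersetCard.1 hT).1 Finset.sdiff_disjoint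
    exact Finset.union_sdiff_cancel_right hd

theorem card_filter_superset_powersetCard_le {α : Type*} [DecidableEq α] {E b : Finset α}
    {k r : ℕ} (hb : b ⊆ E) (hr : r ≤ b.card) (hk : r ≤ k) :
    ((E.powersetCard k).filter (fun S => b ⊆ S)).card ≤ (E.card - r).choose (k - r) := by
  obtain ⟨v, hvb, rfl⟩ := Finset.exists_subset_card_eq hr
  rw [← card_filter_superset_powersetCard (hvb.trans hb) hk]
  exact Finset.card_le_card (Finset.monotone_filter_right _ fun S _ h => hvb.trans h)

theorem sum_card_filter_subset {α : Type*} [DecidableEq α] (B P : Finset (Finset α)) :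
    ∑ S ∈ P, (B.filter (fun b => b ⊆ S)).card = ∑ b ∈ B, (P.filter (fun S => b ⊆ S)).card := by
  simp only [Finset.card_filter]
  exact Finset.sum_comm

theorem sum_card_filter_subset_sq {α : Type*} [DecidableEq α] (B P : Finset (Finset α)) :
    ∑ S ∈ P, (B.filter (fun b => b ⊆ S)).card ^ 2 =
      ∑ b ∈ B, ∑ b' ∈ B, (P.filter (fun S => b ∪ b' ⊆ S)).card := by
  simp only [Finset.card_filter, sq, Finset.sum_mul_sum]
  rw [Finset.sum_comm]
  refine Finset.sum_congr rfl fun b _ => ?_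
  rw [Finset.sum_comm]
  refine Finset.sum_congr rfl fun b' _ => Finset.sum_congr rfl fun S _ => ?_
  by_cases h : b ⊆ S <;> simp [Finset.union_subset_iff, h]

/-- Variance upper bound (Theorem 2): for a butterfly family `B` on `E` with `|E| = n`,
`8 ≤ k ≤ n`, a uniform `k`-sample `S`, `γ = C(n,k)/C(n−4,k−4)` and
`c(S) = γ · |{b ∈ B : b ⊆ S}|`, one has `E[c] = |B|` and
`Var[c] ≤ γ·E[c] + 2γ²·(E[c]·(E[c]−1)/2)·C(n−6,k−6)/C(n,k) − E[c]²`. -/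
theorem abacus_variance_upper_bound
    {α : Type*} [DecidableEq α] (E : Finset α) (n k : ℕ) (B : Finset (Finset α))
    (hE : E.card = n) (hk8 : 8 ≤ k) (hkn : k ≤ n)
    (hB : ∀ b ∈ B, b ⊆ E ∧ b.card = 4)
    (hBint : ∀ b ∈ B, ∀ b' ∈ B, b ≠ b' → (b ∩ b').card ≤ 2) :
    let γ : ℝ := (Nat.choose n k : ℝ) / (Nat.choose (n - 4) (k - 4) : ℝ)
    let c : Finset α → ℝ := fun S => γ * ((B.filter (fun b => b ⊆ S)).card : ℝ)
    let Exp : (Finset α → ℝ) → ℝ :=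
      fun f => (∑ S ∈ E.powersetCard k, f S) / ((E.powersetCard k).card : ℝ)
    Exp c = (B.card : ℝ) ∧
      Exp (fun S => (c S - Exp c) ^ 2) ≤
        γ * Exp c +
          2 * γ ^ 2 * (Exp c * (Exp c - 1) / 2) *
            (Nat.choose (n - 6) (k - 6) : ℝ) / (Nat.choose n k : ℝ) -
          (Exp c) ^ 2 := by
  intro γ c Exp
  have hN : (0 : ℝ) < (n.choose k : ℝ) := by exact_mod_cast Nat.choose_pos hkn
  have hM : (0 : ℝ) < ((n - 4).choose (k - 4) : ℝ) := by
    exact_mod_cast Nat.choose_pos (by omega)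
  have hcard : ((E.powersetCard k).card : ℝ) = n.choose k := by
    rw [Finset.card_powersetCard, hE]
  have hfour : ∀ b ∈ B, ((E.powersetCard k).filter (fun S => b ⊆ S)).card =
      (n - 4).choose (k - 4) := by
    intro b hb
    rw [card_filter_superset_powersetCard (hB b hb).1 (by have := (hB b hb).2; omega),
      (hB b hb).2, hE]
  have hsum : ∑ S ∈ E.powersetCard k, ((B.filter (fun b => b ⊆ S)).card : ℝ) =
      B.card * (n - 4).choose (k - 4) := by
    have h := sum_card_filter_subset B (E.powersetCard k)
    rw [Finset.sum_congr rfl hfour, Finset.sum_const, smul_eq_mul] at h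
    exact_mod_cast h
  have hsq : ∑ S ∈ E.powersetCard k, ((B.filter (fun b => b ⊆ S)).card : ℝ) ^ 2 ≤
      B.card * ((n - 4).choose (k - 4) + (B.card - 1) * (n - 6).choose (k - 6)) := by
    have h : ∀ b ∈ B, ∑ b' ∈ B, ((E.powersetCard k).filter (fun S => b ∪ b' ⊆ S)).card ≤
        (n - 4).choose (k - 4) + (B.card - 1) * (n - 6).choose (k - 6) := by
      intro b hb
      rw [← Finset.add_sum_erase B _ hb, Finset.union_self, hfour b hb,
        ← Finset.card_erase_of_mem hb, ← smul_eq_mul]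
      refine Nat.add_le_add_left (Finset.sum_le_card_nsmul _ _ _ fun b' hb' => ?_) _
      obtain ⟨hne, hb'⟩ := Finset.mem_erase.1 hb'
      have hu := Finset.card_union_add_card_inter b b'
      have hi := hBint b hb b' hb' hne.symm
      have h4 := (hB b hb).2
      have h4' := (hB b' hb').2
      rw [← hE]
      exact card_filter_superset_powersetCard_le
        (Finset.union_subset (hB b hb).1 (hB b' hb').1) (by omega) (by omega)
    have h2 := Finset.sum_le_card_nsmul _ _ _ h
    rw [← sum_card_filter_subset_sq, smul_eq_mul] at h2
    rcases Nat.eq_zero_or_pos B.card with h0 | hpos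
    · rw [h0] at h2 ⊢
      rw [zero_mul] at h2
      rw [Nat.cast_zero, zero_mul]
      exact_mod_cast h2
    · have h3 : ((B.card - 1 : ℕ) : ℝ) = (B.card : ℝ) - 1 := by
        rw [Nat.cast_sub hpos, Nat.cast_one]
      rw [← h3]
      exact_mod_cast h2
  have hmean : Exp c = (B.card : ℝ) := by
    simp only [Exp, c, γ]
    rw [← Finset.mul_sum, hsum, hcard]
    field_simp
  refine ⟨hmean, ?_⟩
  rw [hmean]
  have hvar : Exp (fun S => (c S - B.card) ^ 2) =
      γ ^ 2 * (∑ S ∈ E.powersetCard k, ((B.filter (fun b => b ⊆ S)).card : ℝ) ^ 2) /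
        n.choose k - (B.card : ℝ) ^ 2 := by
    have hexpand : ∀ S ∈ E.powersetCard k, (c S - B.card) ^ 2 =
        γ ^ 2 * ((B.filter (fun b => b ⊆ S)).card : ℝ) ^ 2 -
          2 * γ * B.card * ((B.filter (fun b => b ⊆ S)).card : ℝ) + (B.card : ℝ) ^ 2 := by
      intro S _
      simp only [c]
      ring
    simp only [Exp]
    rw [Finset.sum_congr rfl hexpand, Finset.sum_add_distrib, Finset.sum_sub_distrib,
      ← Finset.mul_sum, ← Finset.mul_sum, hsum, Finset.sum_const, nsmul_eq_mul, hcard]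
    simp only [γ]
    field_simp
    ring
  rw [hvar]
  refine sub_le_sub_right ?_ _
  calc _ ≤ γ ^ 2 * (B.card * ((n - 4).choose (k - 4) +
        (B.card - 1) * (n - 6).choose (k - 6))) / n.choose k := by gcongr
    _ = _ := by
      simp only [γ]
      field_simp
end

section
/- (Butterflies are determined by any three of their edges) For vertices a, c, b, d of a type V with a ≠ c, b ≠ d, and {a, c} ∩ {b, d} = ∅, define the butterfly edge set Q(a, c; b, d) = { ⟦(a,b)⟧, ⟦(a,d)⟧, ⟦(c,b)⟧, ⟦(c,d)⟧ } of unordered pairs (elements of Sym2 V). Then (i) Q(a, c; b, d) has exactly 4 elements, and (ii) if Q(a, c; b, d) and Q(a', c'; b', d') are two such butterfly edge sets whose intersection has at least 3 elements, then Q(a, c; b, d) = Q(a', c'; b', d'). In particular, two distinct butterflies share at most 2 edges. -/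
open Sym2

/-- The edge set of the butterfly (2×2 biclique) on left vertices `a, c` and right
vertices `b, d`: the four unordered pairs `⟦(a,b)⟧, ⟦(a,d)⟧, ⟦(c,b)⟧, ⟦(c,d)⟧`. -/
def butterflyEdges {V : Type*} [DecidableEq V] (a c b d : V) : Finset (Sym2 V) :=
  {s(a, b), s(a, d), s(c, b), s(c, d)}

theorem mk_mem_butterflyEdges {V : Type*} [DecidableEq V] {a c b d x y : V} :
    s(x, y) ∈ butterflyEdges a c b d ↔
      (x = a ∨ x = c) ∧ (y = b ∨ y = d) ∨ (x = b ∨ x = d) ∧ (y = a ∨ y = c) := by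
  simp only [butterflyEdges, Finset.mem_insert, Finset.mem_singleton, Sym2.eq_iff]
  tauto

theorem disjoint_sides {V : Type*} [DecidableEq V] {a c b d : V}
    (h : ({a, c} : Finset V) ∩ {b, d} = ∅) : a ≠ b ∧ a ≠ d ∧ c ≠ b ∧ c ≠ d := by
  rw [← Finset.disjoint_iff_inter_eq_empty] at h
  simp only [Finset.disjoint_insert_left, Finset.disjoint_singleton_left, Finset.mem_insert,
    Finset.mem_singleton, not_or] at h
  exact ⟨h.1.1, h.1.2, h.2⟩

theorem card_butterflyEdges {V : Type*} [DecidableEq V] {a c b d : V}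
    (hac : a ≠ c) (hbd : b ≠ d) (h : ({a, c} : Finset V) ∩ {b, d} = ∅) :
    (butterflyEdges a c b d).card = 4 := by
  obtain ⟨hab, had, hcb, hcd⟩ := disjoint_sides h
  rw [butterflyEdges, Finset.card_insert_of_notMem, Finset.card_insert_of_notMem,
    Finset.card_insert_of_notMem, Finset.card_singleton] <;>
  simp only [Finset.mem_insert, Finset.mem_singleton, Sym2.eq_iff] <;> grind

/-- A path of three edges in a butterfly is closed up to a 4-cycle by an edge of the butterfly. -/
theorem mk_mem_butterflyEdges_of_path {V : Type*} [DecidableEq V] {a c b d x y z w : V}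
    (h : ({a, c} : Finset V) ∩ {b, d} = ∅) (hxw : s(x, w) ∈ butterflyEdges a c b d)
    (hzw : s(z, w) ∈ butterflyEdges a c b d) (hzy : s(z, y) ∈ butterflyEdges a c b d) :
    s(x, y) ∈ butterflyEdges a c b d := by
  obtain ⟨hab, had, hcb, hcd⟩ := disjoint_sides h
  rw [mk_mem_butterflyEdges] at *
  grind

/-- Butterflies are determined by any three of their edges: (i) a butterfly edge set has
exactly 4 elements; (ii) two butterfly edge sets sharing at least 3 edges coincide. -/
theorem butterfly_determined_by_three_edges {V : Type*} [DecidableEq V] :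
    (∀ a c b d : V, a ≠ c → b ≠ d → ({a, c} : Finset V) ∩ {b, d} = ∅ →
      (butterflyEdges a c b d).card = 4) ∧
    (∀ a c b d a' c' b' d' : V,
      a ≠ c → b ≠ d → ({a, c} : Finset V) ∩ {b, d} = ∅ →
      a' ≠ c' → b' ≠ d' → ({a', c'} : Finset V) ∩ {b', d'} = ∅ →
      3 ≤ (butterflyEdges a c b d ∩ butterflyEdges a' c' b' d').card →
      butterflyEdges a c b d = butterflyEdges a' c' b' d') := by
  refine ⟨fun a c b d => card_butterflyEdges, ?_⟩
  intro a c b d a' c' b' d' hac hbd h hac' hbd' h' hcard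
  have hQ := card_butterflyEdges hac hbd h
  have hQ' := card_butterflyEdges hac' hbd' h'
  obtain ⟨hab, had, hcb, hcd⟩ := disjoint_sides h
  have hdiff : (butterflyEdges a c b d \ butterflyEdges a' c' b' d').card ≤ 1 := by
    have := Finset.card_sdiff_add_card_inter (butterflyEdges a c b d) (butterflyEdges a' c' b' d')
    lia
  have hmem : ∀ e ∈ butterflyEdges a c b d, e ∉ butterflyEdges a' c' b' d' →
      ∀ f ∈ butterflyEdges a c b d, f ≠ e → f ∈ butterflyEdges a' c' b' d' := by
    intro e he he' f hf hfe
    by_contra hf'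
    exact hfe (Finset.card_le_one.mp hdiff f (Finset.mem_sdiff.mpr ⟨hf, hf'⟩) e
      (Finset.mem_sdiff.mpr ⟨he, he'⟩))
  have hopp : ∀ x y z w : V, x ≠ z → y ≠ w → x ≠ w → z ≠ y →
      s(x, y) ∈ butterflyEdges a c b d → s(x, w) ∈ butterflyEdges a c b d →
      s(z, w) ∈ butterflyEdges a c b d → s(z, y) ∈ butterflyEdges a c b d →
      s(x, y) ∈ butterflyEdges a' c' b' d' := by
    intro x y z w hxz hyw hxw hzy hxy_mem hxw_mem hzw_mem hzy_mem
    by_contra hxy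
    have key := hmem _ hxy_mem hxy
    refine hxy (mk_mem_butterflyEdges_of_path h' (key _ hxw_mem ?_) (key _ hzw_mem ?_)
      (key _ hzy_mem ?_)) <;> rw [Ne, Sym2.eq_iff] <;> grind
  refine Finset.eq_of_subset_of_card_le (fun e he => ?_) (hQ'.trans hQ.symm).le
  have hab_mem : s(a, b) ∈ butterflyEdges a c b d := by simp [butterflyEdges]
  have had_mem : s(a, d) ∈ butterflyEdges a c b d := by simp [butterflyEdges]
  have hcb_mem : s(c, b) ∈ butterflyEdges a c b d := by simp [butterflyEdges]
  have hcd_mem : s(c, d) ∈ butterflyEdges a c b d := by simp [butterflyEdges]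
  rw [butterflyEdges, Finset.mem_insert, Finset.mem_insert, Finset.mem_insert,
    Finset.mem_singleton] at he
  rcases he with rfl | rfl | rfl | rfl
  · exact hopp a b c d hac hbd had hcb hab_mem had_mem hcd_mem hcb_mem
  · exact hopp a d c b hac hbd.symm hab hcd had_mem hab_mem hcb_mem hcd_mem
  · exact hopp c b a d hac.symm hbd hcd hab hcb_mem hcd_mem had_mem hab_mem
  · exact hopp c d a b hac.symm hbd.symm hcb had hcd_mem hcb_mem hab_mem had_mem
end

section
/- (Correctness of per-edge butterfly counting) Let G be a simple graph on a vertex type V and let u, v be adjacent vertices of G. Let D = { (w, x) ∈ V × V : w ≠ v, x ≠ u, G.Adj u w, G.Adj w x, G.Adj x v }. Then the map sending (w, x) ∈ D to the edge set { ⟦(u,v)⟧, ⟦(u,w)⟧, ⟦(w,x)⟧, ⟦(x,v)⟧ } is injective on D, and for every (w, x) ∈ D the four unordered pairs ⟦(u,v)⟧, ⟦(u,w)⟧, ⟦(w,x)⟧, ⟦(x,v)⟧ are all edges of G and form a 4-element set (a butterfly of G containing the edge {u,v}). -/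
open Sym2

/-- In a four-cycle `u, w, x, v`, the only edges at `u` are `s(u, v)` and `s(u, w)`. -/
lemma eq_or_eq_of_mk_mem_four_cycle {V : Type*} [DecidableEq V] {u v w x y : V}
    (huv : u ≠ v) (huw : u ≠ w) (hux : u ≠ x)
    (h : s(u, y) ∈ ({s(u, v), s(u, w), s(w, x), s(x, v)} : Finset (Sym2 V))) :
    y = v ∨ y = w := by
  simp only [Finset.mem_insert, Finset.mem_singleton, Sym2.eq_iff] at h
  grind

/-- The four edges of a four-cycle are unchanged when it is traversed in reverse. -/
lemma four_cycle_edges_reverse {V : Type*} [DecidableEq V] (u v w x : V) :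
    ({s(u, v), s(u, w), s(w, x), s(x, v)} : Finset (Sym2 V)) =
      {s(v, u), s(v, x), s(x, w), s(w, u)} := by
  rw [Sym2.eq_swap (a := v) (b := u), Sym2.eq_swap (a := v) (b := x),
    Sym2.eq_swap (a := x) (b := w), Sym2.eq_swap (a := w) (b := u)]
  grind

/-- The edges of a four-cycle `u, w, x, v` are pairwise distinct. -/
lemma card_four_cycle_edges {V : Type*} [DecidableEq V] {u v w x : V}
    (huv : u ≠ v) (huw : u ≠ w) (hux : u ≠ x) (hwv : w ≠ v) (hxv : x ≠ v) :
    ({s(u, v), s(u, w), s(w, x), s(x, v)} : Finset (Sym2 V)).card = 4 := by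
  rw [Finset.card_insert_of_notMem, Finset.card_insert_of_notMem, Finset.card_insert_of_notMem,
    Finset.card_singleton] <;>
  simp only [Finset.mem_insert, Finset.mem_singleton, Sym2.eq_iff] <;> grind

/-- Correctness of per-edge butterfly counting: for adjacent vertices `u, v` of a simple
graph `G`, the map sending `(w, x)` with `w ≠ v`, `x ≠ u`, `G.Adj u w`, `G.Adj w x`,
`G.Adj x v` to the edge set `{⟦(u,v)⟧, ⟦(u,w)⟧, ⟦(w,x)⟧, ⟦(x,v)⟧}` is injective on this
domain, and each such edge set consists of 4 edges of `G` (a butterfly containing the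
edge `{u,v}`). -/
theorem per_edge_butterfly_counting_correct
    {V : Type*} [DecidableEq V] (G : SimpleGraph V) (u v : V) (huv : G.Adj u v) :
    Set.InjOn
      (fun p : V × V =>
        ({s(u, v), s(u, p.1), s(p.1, p.2), s(p.2, v)} : Finset (Sym2 V)))
      {p : V × V | p.1 ≠ v ∧ p.2 ≠ u ∧ G.Adj u p.1 ∧ G.Adj p.1 p.2 ∧ G.Adj p.2 v} ∧
    ∀ w x : V, w ≠ v → x ≠ u → G.Adj u w → G.Adj w x → G.Adj x v →
      (s(u, v) ∈ G.edgeSet ∧ s(u, w) ∈ G.edgeSet ∧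
        s(w, x) ∈ G.edgeSet ∧ s(x, v) ∈ G.edgeSet) ∧
      ({s(u, v), s(u, w), s(w, x), s(x, v)} : Finset (Sym2 V)).card = 4 := by
  refine ⟨?_, fun w x hwv hxu huw hwx hxv =>
    ⟨⟨huv, huw, hwx, hxv⟩,
      card_four_cycle_edges huv.ne huw.ne hxu.symm hwv hxv.ne⟩⟩
  rintro ⟨w, x⟩ ⟨hwv, hxu, -, -, -⟩ ⟨w', x'⟩ ⟨hwv', hxu', huw', -, hxv'⟩ h
  dsimp only at *
  have hw : w = w' :=
    (eq_or_eq_of_mk_mem_four_cycle (y := w) huv.ne huw'.ne hxu'.symm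
      (h ▸ by simp)).resolve_left hwv
  rw [four_cycle_edges_reverse u v w x, four_cycle_edges_reverse u v w' x'] at h
  have hx : x = x' :=
    (eq_or_eq_of_mk_mem_four_cycle (y := x) huv.ne' hxv'.ne' hwv'.symm
      (h ▸ by simp)).resolve_left hxu
  rw [hw, hx]
end
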